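/- Let k be a field, V a finite-dimensional k-vector space, and B a bilinear form on V satisfying B(x,y) = εB(y,x) for all x,y ∈ V, where ε ∈ {1,−1}. Let g ∈ GL(V) satisfy B(gx, gy) = B(x,y) for all x,y ∈ V. Let p ≥ 1 be an integer and v ∈ V a vector such that B(v, g^i v) = 0 for all integers i with |i| ≤ p − 1, B(v, g^p v) = 1, and the 2p vectors g^{−p+i} v (i ∈ [0, 2p−1]) are linearly independent. Let X be the subspace of V spanned by these 2p vectors and let X^⊥ = {y ∈ V : B(y, x) = 0 for all x ∈ X}. Then X ∩ X^⊥ = 0 and V = X ⊕ X^⊥. -/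

import Mathlib

/-- For a bilinear form `B` and a subspace `X`, the perpendicular subspace
`X^⊥ = {y ∈ V : B(y,x) = 0 for all x ∈ X}`. -/
def perpSub {k V : Type*} [Field k] [AddCommGroup V] [Module k V]
    (B : V →ₗ[k] V →ₗ[k] k) (X : Submodule k V) : Submodule k V where
  carrier := {y | ∀ x ∈ X, B y x = 0}
  add_mem' := by
    intro a b ha hb
    simp only [Set.mem_setOf_eq] at *
    intro x hx
    rw [map_add, LinearMap.add_apply, ha x hx, hb x hx, add_zero]
  zero_mem' := by
    simp only [Set.mem_setOf_eq]
    intro x hx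
    rw [map_zero, LinearMap.zero_apply]
  smul_mem' := by
    intro c a ha
    simp only [Set.mem_setOf_eq] at *
    intro x hx
    rw [map_smul, LinearMap.smul_apply, ha x hx, smul_zero]

/-- let `B` be a symmetric or skew-symmetric bilinear form on `V`, preserved by
`g ∈ GL(V)`. Let `p ≥ 1` and `v ∈ V` with `B(v, g^i v) = 0` for `|i| ≤ p−1`, `B(v, g^p v) = 1`,
and the `2p` vectors `g^{−p+i} v` (`i ∈ [0, 2p−1]`) linearly independent. If `X` is their span,
then `X ∩ X^⊥ = 0` and `V = X ⊕ X^⊥`. -/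
theorem stmt_8 {k : Type*} [Field k] {V : Type*} [AddCommGroup V] [Module k V]
    [FiniteDimensional k V]
    (B : V →ₗ[k] V →ₗ[k] k) (ε : k) (hε : ε = 1 ∨ ε = -1)
    (hsymm : ∀ x y : V, B x y = ε * B y x)
    (g : V ≃ₗ[k] V) (hg : ∀ x y : V, B (g x) (g y) = B x y)
    (p : ℕ) (hp : 1 ≤ p) (v : V)
    (h0 : ∀ i : ℤ, |i| ≤ (p : ℤ) - 1 → B v ((g ^ i) v) = 0)
    (h1 : B v ((g ^ (p : ℤ)) v) = 1)
    (hli : LinearIndependent k (fun i : Fin (2 * p) => (g ^ (-(p : ℤ) + (i : ℕ))) v)) :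
    Submodule.span k (Set.range fun i : Fin (2 * p) => (g ^ (-(p : ℤ) + (i : ℕ))) v)
        ⊓ perpSub B (Submodule.span k
          (Set.range fun i : Fin (2 * p) => (g ^ (-(p : ℤ) + (i : ℕ))) v)) = ⊥ ∧
      Submodule.span k (Set.range fun i : Fin (2 * p) => (g ^ (-(p : ℤ) + (i : ℕ))) v)
        ⊔ perpSub B (Submodule.span k
          (Set.range fun i : Fin (2 * p) => (g ^ (-(p : ℤ) + (i : ℕ))) v)) = ⊤ := by
  have hgz : ∀ (n : ℤ) (x y : V), B ((g ^ n) x) ((g ^ n) y) = B x y := by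
    intro n
    induction n using Int.induction_on with
    | zero => intro x y; simp
    | succ n ih =>
      intro x y
      rw [zpow_add_one, LinearEquiv.mul_apply, LinearEquiv.mul_apply, ih, hg]
    | pred n ih =>
      intro x y
      have h := ih (g⁻¹ x) (g⁻¹ y)
      rw [zpow_sub_one, LinearEquiv.mul_apply, LinearEquiv.mul_apply, h, ← hg]
      rw [← LinearEquiv.mul_apply, ← LinearEquiv.mul_apply, mul_inv_cancel]
      simp
  have hf : ∀ a b : ℤ, B ((g ^ a) v) ((g ^ b) v) = B v ((g ^ (b - a)) v) := by
    intro a b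
    have h := hgz a v ((g ^ (b - a)) v)
    rwa [← LinearEquiv.mul_apply, ← zpow_add, add_sub_cancel] at h
  have hε0 : ε ≠ 0 := by rcases hε with h | h <;> simp [h]
  have hneg : B v ((g ^ (-(p : ℤ))) v) = ε := by
    have h := hf (-(p : ℤ)) 0
    rw [zero_sub, neg_neg, h1] at h
    rw [hsymm]
    simpa using congrArg (ε * ·) h
  set w : Fin (2 * p) → V := fun i => (g ^ (-(p : ℤ) + (i : ℕ))) v with hw
  have hwB : ∀ i j : Fin (2 * p), B (w i) (w j) = B v ((g ^ ((j : ℤ) - (i : ℤ))) v) := by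
    intro i j
    simp only [hw]
    rw [hf]
    congr 3
    ring
  have key : Submodule.span k (Set.range w) ⊓ perpSub B (Submodule.span k (Set.range w)) = ⊥ := by
    rw [eq_bot_iff]
    rintro x ⟨hx, hx'⟩
    obtain ⟨c, rfl⟩ := (Submodule.mem_span_range_iff_exists_fun k).1 hx
    have hsum : ∀ j : Fin (2 * p), ∑ i, c i * B v ((g ^ ((j : ℤ) - (i : ℤ))) v) = 0 := by
      intro j
      have h := hx' (w j) (Submodule.subset_span ⟨j, rfl⟩)
      simpa [map_sum, LinearMap.sum_apply, hwB] using h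
    have first : ∀ m : ℕ, ∀ hm : m < p, c ⟨m, by omega⟩ = 0 := by
      intro m
      induction m using Nat.strong_induction_on with
      | _ m ih =>
        intro hm
        have h := hsum ⟨m + p, by omega⟩
        rw [Finset.sum_eq_single ⟨m, by omega⟩] at h
        · have e : (((m + p : ℕ) : ℤ) - (m : ℤ)) = (p : ℤ) := by omega
          simp only [e, h1, mul_one] at h
          exact h
        · intro i _ hi
          have hi' : (i : ℕ) ≠ m := fun e => hi (Fin.ext e)
          rcases lt_or_gt_of_ne hi' with hlt | hgt
          · rw [show c i = 0 from ih i hlt (by omega), zero_mul]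
          · rw [h0, mul_zero]
            have := i.2
            rw [abs_le]; push_cast; omega
        · simp
    have second : ∀ n : ℕ, ∀ hn : n < p, c ⟨2 * p - 1 - n, by omega⟩ = 0 := by
      intro n
      induction n using Nat.strong_induction_on with
      | _ n ih =>
        intro hn
        have h := hsum ⟨p - 1 - n, by omega⟩
        rw [Finset.sum_eq_single ⟨2 * p - 1 - n, by omega⟩] at h
        · have e : (((p - 1 - n : ℕ) : ℤ) - ((2 * p - 1 - n : ℕ) : ℤ)) = -(p : ℤ) := by omega
          simp only [e, hneg] at h
          exact (mul_eq_zero.1 h).resolve_right hε0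
        · intro i _ hi
          have hi' : (i : ℕ) ≠ 2 * p - 1 - n := fun e => hi (Fin.ext e)
          have := i.2
          rcases lt_or_gt_of_ne hi' with hlt | hgt
          · rw [h0, mul_zero]
            rw [abs_le]
            dsimp only
            omega
          · have h2 := ih (2 * p - 1 - i) (by omega) (by omega)
            have e : (⟨2 * p - 1 - (2 * p - 1 - i), by omega⟩ : Fin (2 * p)) = i :=
              Fin.ext (by dsimp only; omega)
            rw [e] at h2
            rw [h2, zero_mul]
        · simp
    have hc : ∀ i, c i = 0 := by
      intro i
      have := i.2
      by_cases hi : (i : ℕ) < p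
      · exact first i hi
      · have h2 := second (2 * p - 1 - i) (by omega)
        have e : (⟨2 * p - 1 - (2 * p - 1 - i), by omega⟩ : Fin (2 * p)) = i :=
          Fin.ext (by dsimp only; omega)
        rwa [e] at h2
    simp [hc]
  have hrefl : LinearMap.BilinForm.IsRefl B := by
    intro x y h
    rw [hsymm, h, mul_zero]
  have hperp : perpSub B (Submodule.span k (Set.range w)) =
      LinearMap.BilinForm.orthogonal B (Submodule.span k (Set.range w)) := by
    ext y
    rw [LinearMap.BilinForm.mem_orthogonal_iff]
    exact ⟨fun h x hx => hrefl _ _ (h x hx), fun h x hx => hrefl _ _ (h x hx)⟩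
  refine ⟨key, ?_⟩
  rw [hperp] at key ⊢
  exact ((LinearMap.BilinForm.isCompl_orthogonal_iff_disjoint hrefl).2
    (disjoint_iff.2 key)).sup_eq_top
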